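/- If α ∈ K^× is an s-exceptional element, then α is m-exceptional for all 1 ≤ m < s. More precisely, if (α, {δ̌_i}_{i=0}^{s}) represents a minimal norm pair ((a_0,…,a_{s-1}), d) of length s, then (α, {δ_i}_{i=0}^{m}) represents the minimal norm pair ((a_0,…,a_{m-1}), d) of length m, where δ_i = δ̌_i for all 0 ≤ i < m and δ_m = ∏_{i=m}^{s} δ̌_i^{p^{i-m}}. -/

import Mathlib

/-!
Common setup.  Throughout, `K/F` is a cyclic Galois extension of degree `p^n`
with Galois group `G = Gal(K/F)` generated by `σ`.  For `0 ≤ i ≤ n`, `K_i`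
denotes the intermediate field of degree `p^i` over `F`, realized here via its
unit group `KiU p σ i` (the units of `K` fixed by `σ^{p^i}`), and
`G_i = Gal(K_i/F)`.  For `m ≥ 1`, `R_m = ℤ/p^m` and `J_m = K^×/K^{×p^m}`.
-/

namespace MSS

variable {F K : Type*} [Field F] [Field K] [Algebra F K]

/-- Action of a field automorphism on the unit group. -/
def umap (σ : K ≃ₐ[F] K) : Kˣ →* Kˣ := Units.map (σ : K →* K)

/-- The norm from `K_j` to `F`, computed in `K` as the product of conjugates
`∏_{k < p^j} σ^k(γ)` (valid for `γ ∈ K_j`). -/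
noncomputable def normHom (p : ℕ) (σ : K ≃ₐ[F] K) (j : ℕ) : Kˣ →* Kˣ :=
  ∏ k ∈ Finset.range (p ^ j), umap (σ ^ k)

/-- The unit group of the intermediate field `K_i`: the units fixed by `σ^{p^i}`. -/
def KiU (p : ℕ) (σ : K ≃ₐ[F] K) (i : ℕ) : Subgroup Kˣ :=
  (umap (σ ^ p ^ i) / MonoidHom.id Kˣ).ker

/-- Membership in `K_a^×` for a level `a ∈ {-∞, 0, 1, …}`; level `-∞` means
the trivial group `{1}`. -/
def levelMem (p : ℕ) (σ : K ≃ₐ[F] K) (a : WithBot ℕ) (γ : Kˣ) : Prop :=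
  WithBot.recBotCoe (γ = 1) (fun i => γ ∈ KiU p σ i) a

/-- `(α, δ)` represents the pair `(a, d)`:  `σ(α)·α^{-d} = ∏_{i=0}^m δ_i^{p^i}` with
`δ_i ∈ K_{a_i}^×` for `i < m`, and
`ξ_p = N_{K/F}(α)^{(d-1)/p} · N_{K_{n-1}/F}(δ_0) · ∏_{i=1}^m N_{K/F}(δ_i)^{p^{i-1}}`. -/
noncomputable def Represents (p n : ℕ) (σ : K ≃ₐ[F] K) (ξ : Kˣ) {m : ℕ}
    (a : Fin m → WithBot ℕ) (d : ℤ) (α : Kˣ) (δ : ℕ → Kˣ) : Prop :=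
  (∀ i : Fin m, levelMem p σ (a i) (δ i)) ∧
  umap σ α = α ^ d * ∏ i ∈ Finset.range (m + 1), δ i ^ p ^ i ∧
  ξ = normHom p σ n α ^ ((d - 1) / (p : ℤ)) * normHom p σ (n - 1) (δ 0) *
      ∏ i ∈ Finset.Icc 1 m, normHom p σ n (δ i) ^ p ^ (i - 1)

/-- `(a, d)` is a norm pair of length `m`: `a ∈ {-∞,0,…,n}^m` with `a_0 < n`,
`d ∈ U_1`, and some `(α, δ)` represents `(a, d)`. -/
noncomputable def IsNormPair (p n : ℕ) (σ : K ≃ₐ[F] K) (ξ : Kˣ) {m : ℕ}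
    (a : Fin m → WithBot ℕ) (d : ℤ) : Prop :=
  (∀ i, a i ≤ (n : WithBot ℕ)) ∧
  (∀ h0 : 0 < m, a ⟨0, h0⟩ < (n : WithBot ℕ)) ∧
  (p : ℤ) ∣ d - 1 ∧
  ∃ (α : Kˣ) (δ : ℕ → Kˣ), Represents p n σ ξ a d α δ

/-- Strict lexicographic order on norm vectors (with `-∞` smallest). -/
def vecLT {m : ℕ} (a a' : Fin m → WithBot ℕ) : Prop :=
  ∃ k : Fin m, (∀ j : Fin m, j < k → a j = a' j) ∧ a k < a' k

/-- The order `d ≤_m d'` on twists: `d' ∈ U_i → d ∈ U_i` for `1 ≤ i ≤ m`, except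
when `p = 2` and `d, d' ∉ U_2`, in which case `d' ∈ -U_i → d ∈ -U_i` for `2 ≤ i ≤ m`. -/
def twistLE (p m : ℕ) (d d' : ℤ) : Prop :=
  ((p = 2 ∧ ¬ (4 : ℤ) ∣ (d - 1) ∧ ¬ (4 : ℤ) ∣ (d' - 1)) →
    ∀ i : ℕ, 2 ≤ i → i ≤ m → ((2 : ℤ) ^ i ∣ (d' + 1)) → ((2 : ℤ) ^ i ∣ (d + 1))) ∧
  (¬ (p = 2 ∧ ¬ (4 : ℤ) ∣ (d - 1) ∧ ¬ (4 : ℤ) ∣ (d' - 1)) →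
    ∀ i : ℕ, 1 ≤ i → i ≤ m → ((p : ℤ) ^ i ∣ (d' - 1)) → ((p : ℤ) ^ i ∣ (d - 1)))

/-- The order `⪯_m` on norm pairs of length `m`. -/
def pairLE (p : ℕ) {m : ℕ} (a : Fin m → WithBot ℕ) (d : ℤ)
    (a' : Fin m → WithBot ℕ) (d' : ℤ) : Prop :=
  vecLT a a' ∨ (a = a' ∧ twistLE p m d d')

/-- `(a, d)` is a minimal norm pair of length `m`. -/
noncomputable def IsMinimalNormPair (p n : ℕ) (σ : K ≃ₐ[F] K) (ξ : Kˣ) {m : ℕ}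
    (a : Fin m → WithBot ℕ) (d : ℤ) : Prop :=
  IsNormPair p n σ ξ a d ∧
  ∀ (a' : Fin m → WithBot ℕ) (d' : ℤ), IsNormPair p n σ ξ a' d' → pairLE p a d a' d'

/-- `α` is an `m`-exceptional element. -/
noncomputable def IsExceptional (p n : ℕ) (σ : K ≃ₐ[F] K) (ξ : Kˣ) (m : ℕ) (α : Kˣ) : Prop :=
  ∃ (a : Fin m → WithBot ℕ) (d : ℤ) (δ : ℕ → Kˣ),
    IsMinimalNormPair p n σ ξ a d ∧ Represents p n σ ξ a d α δ

/-- The subgroup of `q`-th powers in `K^×`. -/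
def powSub (K : Type*) [Field K] (q : ℕ) : Subgroup Kˣ := (powMonoidHom q : Kˣ →* Kˣ).range

/-- The class of a unit in `J_q := K^×/K^{×q}`. -/
def jcls (q : ℕ) (γ : Kˣ) : Kˣ ⧸ powSub K q := QuotientGroup.mk γ

/-- The action of a field automorphism on `J_q = K^×/K^{×q}`. -/
noncomputable def jmap (q : ℕ) (τ : K ≃ₐ[F] K) : (Kˣ ⧸ powSub K q) →* Kˣ ⧸ powSub K q :=
  QuotientGroup.map _ _ (umap τ) (by
    rintro x ⟨y, rfl⟩
    exact ⟨umap τ y, by simp [powMonoidHom, map_pow]⟩)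

/-- The natural map `J_q → J_{q'}` when `q' ∣ q`. -/
noncomputable def resMap (q q' : ℕ) (h : q' ∣ q) : (Kˣ ⧸ powSub K q) →* Kˣ ⧸ powSub K q' :=
  QuotientGroup.map _ _ (MonoidHom.id Kˣ) (by
    rintro x ⟨y, rfl⟩
    obtain ⟨c, rfl⟩ := h
    exact ⟨y ^ c, by simp [powMonoidHom, ← pow_mul, mul_comm]⟩)

/-- The `R_m[G]`-submodule of `J_q` generated by the classes of the elements of `S`:
the subgroup generated by all `σ^k`-conjugates of classes of elements of `S`. -/
noncomputable def galSpan (q : ℕ) (σ : K ≃ₐ[F] K) (S : Set Kˣ) : Subgroup (Kˣ ⧸ powSub K q) :=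
  Subgroup.closure {x | ∃ γ ∈ S, ∃ k : ℕ, x = jcls q (umap (σ ^ k) γ)}

/-- The subgroup `(σ-1)J_q` of `J_q`. -/
noncomputable def augSub (q : ℕ) (σ : K ≃ₐ[F] K) : Subgroup (Kˣ ⧸ powSub K q) :=
  Subgroup.closure {x | ∃ y : Kˣ ⧸ powSub K q, x = jmap q σ y * y⁻¹}

/-- The cyclic `F_p[G]`-submodule of `J_1 = K^×/K^{×p}` generated by `[γ]_1` is a
free `F_p[G_i]`-module (on the generator `[γ]_1`): `[γ]_1` is fixed by `σ^{p^i}`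
and the conjugates `σ^k [γ]_1`, `k < p^i`, are `F_p`-linearly independent. -/
noncomputable def FreeCyc (p : ℕ) (σ : K ≃ₐ[F] K) (i : ℕ) (γ : Kˣ) : Prop :=
  jcls p (umap (σ ^ p ^ i) γ) = jcls p γ ∧
  ∀ c : Fin (p ^ i) → ZMod p,
    (∏ k : Fin (p ^ i), jcls p (umap (σ ^ (k : ℕ)) γ) ^ (c k).val) = 1 → c = 0

/-- An (indexed) internal direct sum decomposition of a commutative group. -/
def IsDirectSumDecomp {G : Type*} [CommGroup G] {ι : Sort*} (f : ι → Subgroup G) : Prop :=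
  iSupIndep f ∧ (⨆ i, f i) = ⊤

/-- The subgroup `F^×` of `K^×` (units coming from the base field). -/
def Funits (F : Type*) {K : Type*} [Field F] [Field K] [Algebra F K] : Subgroup Kˣ :=
  (Units.map (algebraMap F K : F →* K)).range

/-- The subgroup `F^{×p}` of `K^×`. -/
def FpPow (F : Type*) {K : Type*} [Field F] [Field K] [Algebra F K] (p : ℕ) : Subgroup Kˣ :=
  (Funits F).map (powMonoidHom p)

/-- The subgroup `N_{K_i/F}(K_i^×)` of `K^×`. -/
noncomputable def NormSub (p : ℕ) (σ : K ≃ₐ[F] K) (i : ℕ) : Subgroup Kˣ :=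
  (KiU p σ i).map (normHom p σ i)

/-- The subgroup `N_{K_i/F}(K_i^×)·F^{×p}` of `K^×`. -/
noncomputable def NiF (p : ℕ) (σ : K ≃ₐ[F] K) (i : ℕ) : Subgroup Kˣ :=
  NormSub p σ i ⊔ FpPow F p

/-- The `F_p`-dimension of an (elementary abelian `p`-) commutative group `Q`,
computed as the rank of `F_p ⊗_ℤ Q`. -/
noncomputable def fpdim (p : ℕ) (Q : Type*) [CommGroup Q] : Cardinal :=
  Module.rank (ZMod p) (TensorProduct ℤ (ZMod p) (Additive Q))

/-- The invariant `e_i(K/F)`: for `i < n` the `F_p`-dimension of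
`N_{K_i/F}(K_i^×)F^{×p} / N_{K_{i+1}/F}(K_{i+1}^×)F^{×p}`, and for `i = n` the
`F_p`-dimension of `N_{K/F}(K^×)F^{×p}/F^{×p}`. -/
noncomputable def eKF (p n : ℕ) (σ : K ≃ₐ[F] K) (i : ℕ) : Cardinal :=
  if i < n then
    fpdim p ((NiF p σ i) ⧸ (NiF p σ (i + 1)).subgroupOf (NiF p σ i))
  else
    fpdim p ((NiF p σ n) ⧸ (FpPow F p).subgroupOf (NiF p σ n))

/-- The group ring `R_m[G_i] = (ℤ/p^m)[ℤ/p^i]` (for the cyclic group `G_i` of order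
`p^i`). -/
abbrev CycGR (p m i : ℕ) : Type :=
  MonoidAlgebra (ZMod (p ^ m)) (Multiplicative (ZMod (p ^ i)))

/-- The image of the generator `σ` of `G_i` in the group ring `R_m[G_i]`. -/
noncomputable def gen (p m i : ℕ) : CycGR p m i :=
  MonoidAlgebra.of _ _ (Multiplicative.ofAdd (1 : ZMod (p ^ i)))

/-- Standard basis vector of the free `R_m[G]`-module on generators `e_0, …, e_m`. -/
noncomputable def sing (p n m : ℕ) (j : Fin (m + 1)) (c : CycGR p m n) :
    Fin (m + 1) → CycGR p m n :=
  Pi.single j c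

/-- The relations defining the module `X_{a,d,m}`: on generators `y = e_0` and
`x_i = e_{i+1}` (`0 ≤ i < m`), we impose `(σ - d)·y = Σ_i p^i x_i`, and
`(σ^{p^{a_i}} - 1)·x_i = 0` when `a_i ≠ -∞`, resp. `x_i = 0` when `a_i = -∞`. -/
noncomputable def XRels (p n m : ℕ) (a : Fin m → WithBot ℕ) (d : ℤ) :
    Set (Fin (m + 1) → CycGR p m n) :=
  insert
    (sing p n m 0 (gen p m n - (d : ZMod (p ^ m)) • 1) -
      ∑ i : Fin m, sing p n m i.succ ((p : CycGR p m n) ^ (i : ℕ)))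
    {r | ∃ i : Fin m, r = sing p n m i.succ
      (WithBot.recBotCoe (1 : CycGR p m n) (fun k => gen p m n ^ p ^ k - 1) (a i))}

/-- The `R_m[G]`-module `X_{a,d,m}`. -/
noncomputable abbrev Xadm (p n m : ℕ) (a : Fin m → WithBot ℕ) (d : ℤ) :=
  (Fin (m + 1) → CycGR p m n) ⧸ Submodule.span (CycGR p m n) (XRels p n m a d)

/-- Indecomposability of a module. -/
def IsIndecomposable (R M : Type*) [Ring R] [AddCommGroup M] [Module R M] : Prop :=
  (⊤ : Submodule R M) ≠ ⊥ ∧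
  ∀ S T : Submodule R M, S ⊓ T = ⊥ → S ⊔ T = ⊤ → S = ⊥ ∨ T = ⊥

end MSS

section Contraction

open Polynomial

/-- The homogeneous geometric sum `∑_{j < N} X^j c^{N-1-j}`. -/
noncomputable def geomPoly (c : ℤ) (N : ℕ) : ℤ[X] :=
  ∑ j ∈ Finset.range N, X ^ j * (c : ℤ[X]) ^ (N - 1 - j)

lemma geomPoly_mul (c : ℤ) (N : ℕ) :
    (X - (c : ℤ[X])) * geomPoly c N = X ^ N - (c : ℤ[X]) ^ N := by
  rw [mul_comm]
  exact (Commute.all _ _).geom_sum₂_mul N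

lemma geomPoly_one (N : ℕ) : geomPoly 1 N = ∑ j ∈ Finset.range N, X ^ j := by
  simp [geomPoly]

lemma X_sub_cast_ne_zero (c : ℤ) : (X - (c : ℤ[X])) ≠ 0 := by
  have := X_sub_C_ne_zero c
  simpa using this

/-- Factorisation of a geometric sum of length `N * M`. -/
lemma geomPoly_mul_length (c : ℤ) (N M : ℕ) :
    geomPoly c (N * M) = geomPoly c N * (geomPoly (c ^ N) M).comp (X ^ N) := by
  apply mul_left_cancel₀ (X_sub_cast_ne_zero c)
  have h := congrArg (fun f : ℤ[X] => f.comp (X ^ N)) (geomPoly_mul (c ^ N) M)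
  simp only [mul_comp, sub_comp, X_comp, pow_comp, intCast_comp] at h
  rw [← mul_assoc, geomPoly_mul, geomPoly_mul, pow_mul, pow_mul]
  push_cast at h
  exact h.symm

lemma eval_one_geomPoly (c : ℤ) (N : ℕ) :
    (geomPoly c N).eval 1 = ∑ j ∈ Finset.range N, c ^ j := by
  simp only [geomPoly, eval_finsetSum, eval_mul, eval_pow, eval_X, one_pow, one_mul,
    eval_intCast]
  exact Finset.sum_range_reflect (fun j => c ^ j) N

lemma X_sub_one_dvd_sub_eval_one (f : ℤ[X]) : (X - 1 : ℤ[X]) ∣ f - ((f.eval 1 : ℤ) : ℤ[X]) := by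
  have := X_sub_C_dvd_sub_C_eval (a := (1 : ℤ)) (p := f)
  simpa using this

lemma X_pow_sub_one_dvd_comp_sub_eval_one (f : ℤ[X]) (N : ℕ) :
    (X ^ N - 1 : ℤ[X]) ∣ f.comp (X ^ N) - ((f.eval 1 : ℤ) : ℤ[X]) := by
  obtain ⟨g, hg⟩ := X_sub_one_dvd_sub_eval_one f
  refine ⟨g.comp (X ^ N), ?_⟩
  have h := congrArg (fun f : ℤ[X] => f.comp (X ^ N)) hg
  simpa using h

lemma X_pow_sub_one_dvd_of_dvd_prime_mul {p : ℕ} (hp : p.Prime) {N : ℕ} (hN : 0 < N) {f : ℤ[X]}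
    (h : (X ^ N - 1 : ℤ[X]) ∣ (p : ℤ[X]) * f) : (X ^ N - 1 : ℤ[X]) ∣ f := by
  obtain ⟨g, hg⟩ := h
  have hpp : Prime (p : ℤ[X]) := by
    have : Prime (C (p : ℤ)) := prime_C_iff.2 (Nat.prime_iff_prime_int.1 hp)
    simpa using this
  have hmon : (X ^ N - 1 : ℤ[X]).Monic := by
    simpa using monic_X_pow_sub_C (1 : ℤ) hN.ne'
  rcases hpp.dvd_or_dvd (Dvd.intro _ hg) with h1 | ⟨k, rfl⟩
  · exfalso
    have h2 : C (p : ℤ) ∣ (X ^ N - 1 : ℤ[X]) := by simpa using h1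
    have h3 := (C_dvd_iff_dvd_coeff _ _).1 h2 (X ^ N - 1 : ℤ[X]).natDegree
    rw [coeff_natDegree, hmon.leadingCoeff] at h3
    exact (Nat.prime_iff_prime_int.1 hp).not_isUnit (isUnit_of_dvd_one h3)
  · refine ⟨k, mul_left_cancel₀ hpp.ne_zero ?_⟩
    rw [hg]; ring

lemma geom_sum_mul_length (c : ℤ) (N M : ℕ) :
    ∑ j ∈ Finset.range (N * M), c ^ j =
      (∑ j ∈ Finset.range N, c ^ j) * ∑ j ∈ Finset.range M, (c ^ N) ^ j := by
  have h := congrArg (eval 1) (geomPoly_mul_length c N M)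
  simpa [eval_one_geomPoly, eval_comp] using h

lemma dvd_geom_sum_of_dvd_sub_one {p : ℕ} {c : ℤ} (hc : (p : ℤ) ∣ c - 1) :
    (p : ℤ) ∣ ∑ j ∈ Finset.range p, c ^ j := by
  have h : ∑ j ∈ Finset.range p, c ^ j = ∑ j ∈ Finset.range p, (c ^ j - 1) + p := by
    simp
  rw [h]
  exact dvd_add (Finset.dvd_sum fun j _ => hc.trans (sub_one_dvd_pow_sub_one c j)) dvd_rfl

/-- A geometric sum of length `p^r` with ratio `≡ 1 (mod p)` is divisible by `p^r`. -/
lemma prime_pow_dvd_geom_sum {p : ℕ} {c : ℤ} (hc : (p : ℤ) ∣ c - 1) (r : ℕ) :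
    (p : ℤ) ^ r ∣ ∑ j ∈ Finset.range (p ^ r), c ^ j := by
  induction r with
  | zero => simp
  | succ r ih =>
    rw [pow_succ, pow_succ, geom_sum_mul_length]
    exact mul_dvd_mul ih
      (dvd_geom_sum_of_dvd_sub_one (hc.trans (sub_one_dvd_pow_sub_one c _)))

/-- If `c ≡ 1 (mod p^k)` with `k ≥ 1`, then `c^{p^n} ≡ 1 (mod p^{k+n})`. -/
lemma prime_pow_dvd_pow_sub_one {p k : ℕ} {c : ℤ} (hk : 1 ≤ k) (hc : (p : ℤ) ^ k ∣ c - 1)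
    (n : ℕ) : (p : ℤ) ^ (k + n) ∣ c ^ p ^ n - 1 := by
  rw [← mul_geom_sum, pow_add]
  exact mul_dvd_mul hc (prime_pow_dvd_geom_sum ((dvd_pow_self _ (by lia)).trans hc) n)

/-- The coefficient polynomial of `δ_i` in the norm condition. -/
noncomputable def normCoeff (p n : ℕ) : ℕ → ℤ[X]
  | 0 => geomPoly 1 (p ^ (n - 1))
  | i + 1 => (p : ℤ[X]) ^ i * geomPoly 1 (p ^ n)

section Module

variable {A : Type*} [AddCommGroup A] [Module ℤ[X] A]

lemma smul_eq_of_dvd_sub {f g h : ℤ[X]} {x : A} (hdvd : f ∣ g - h) (hx : f • x = 0) :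
    g • x = h • x := by
  obtain ⟨k, hk⟩ := hdvd
  rw [← sub_eq_zero, ← sub_smul, hk, mul_comm, mul_smul, hx, smul_zero]

/-- The norm kills the augmentation ideal. -/
lemma geomPoly_one_mul_smul {N : ℕ} {x : A} (hx : (X ^ N - 1 : ℤ[X]) • x = 0) (f : ℤ[X]) :
    (geomPoly 1 N * f) • x = ((f.eval 1 : ℤ) : ℤ[X]) • geomPoly 1 N • x := by
  rw [← mul_smul, mul_comm _ (geomPoly 1 N)]
  refine smul_eq_of_dvd_sub ?_ hx
  obtain ⟨g, hg⟩ := X_sub_one_dvd_sub_eval_one f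
  have h := geomPoly_mul 1 N
  simp only [Int.cast_one, one_pow] at h
  refine ⟨g, ?_⟩
  rw [← mul_sub, hg, ← h]
  ring

lemma X_pow_sub_one_dvd_of_dvd {N M : ℕ} (h : N ∣ M) : (X ^ N - 1 : ℤ[X]) ∣ X ^ M - 1 := by
  obtain ⟨k, rfl⟩ := h
  rw [pow_mul]
  exact sub_one_dvd_pow_sub_one _ _

/-- `(α, δ)` satisfies the two equations of a representation of a norm pair with twist `d`,
written additively over `ℤ[X]`, where `X` acts as `σ`. -/
def SatisfiesNormEqs (p n m : ℕ) (ξ : A) (d : ℤ) (α : A) (δ : ℕ → A) : Prop :=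
  (X - (d : ℤ[X])) • α = ∑ i ∈ Finset.range (m + 1), (p : ℤ[X]) ^ i • δ i ∧
  ξ = (((d - 1) / p : ℤ) : ℤ[X]) • geomPoly 1 (p ^ n) • α +
    ∑ i ∈ Finset.range (m + 1), normCoeff p n i • δ i

/-- Modulo `X^{p^b} - 1`, the coefficient of `δ_i` in the norm condition is
`p^{i-1}` times the full norm. -/
lemma X_pow_sub_one_dvd_normCoeff {p n i b : ℕ}
    (h0 : i = 0 → b < n) :
    (X ^ p ^ b - 1 : ℤ[X]) ∣ p * normCoeff p n i - p ^ i * geomPoly 1 (p ^ n) := by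
  cases i with
  | succ i => simp only [normCoeff]; exact ⟨0, by ring⟩
  | zero =>
    obtain ⟨n, rfl⟩ : ∃ r, n = r + 1 := ⟨n - 1, by have := h0 rfl; lia⟩
    have hb : b ≤ n := by have := h0 rfl; lia
    have h := X_pow_sub_one_dvd_comp_sub_eval_one (geomPoly 1 p) (p ^ n)
    rw [eval_one_geomPoly] at h
    have h2 := (X_pow_sub_one_dvd_of_dvd (pow_dvd_pow p hb)).trans h
    obtain ⟨g, hg⟩ := h2
    refine ⟨- geomPoly 1 (p ^ n) * g, ?_⟩
    simp only [normCoeff, Nat.add_sub_cancel, pow_succ p n, geomPoly_mul_length, one_pow]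
    simp at hg
    linear_combination (- geomPoly 1 (p ^ n)) * hg

/-- The contribution of a single `δ_i` to the root of unity attached to a norm pair. -/
lemma exists_torsion_contribution {p n i M b : ℕ} (hp : p.Prime) (hM : 1 ≤ M) {d e : ℤ}
    {R : ℤ[X]} (hR : (p : ℤ[X]) * R = geomPoly d (p ^ n) - geomPoly 1 (p ^ n))
    (he : (p : ℤ) ^ M * e = d ^ p ^ n - 1) (hbn : b ≤ n)
    (hdvd : (p : ℤ) ^ M ∣ p ^ i * ∑ j ∈ Finset.range (p ^ (n - b)), (d ^ p ^ b) ^ j)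
    {x : A} (hx : (X ^ p ^ b - 1 : ℤ[X]) • x = 0) :
    ∃ z : A, (X - (d : ℤ[X])) • z = -(((e : ℤ[X]) * (p : ℤ[X]) ^ i) • x) ∧
      (p : ℤ[X]) ^ (M - 1) • z = ((p : ℤ[X]) ^ i * R + normCoeff p n i) • x := by
  obtain ⟨c, hc⟩ := hdvd
  have h0 : i = 0 → b < n := by
    rintro rfl
    by_contra hb
    obtain rfl : b = n := by lia
    simp at hc
    have : (p : ℤ) ∣ 1 := ⟨p ^ (M - 1) * c, by rw [hc, ← mul_assoc, ← pow_succ']; congr 2; lia⟩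
    exact (Nat.prime_iff_prime_int.1 hp).not_isUnit (isUnit_of_dvd_one this)
  obtain ⟨M, rfl⟩ : ∃ r, M = r + 1 := ⟨M - 1, by lia⟩
  have hq : p ^ n = p ^ b * p ^ (n - b) := by rw [← pow_add]; congr 1; lia
  refine ⟨((c : ℤ[X]) * geomPoly d (p ^ b)) • x, ?_, ?_⟩
  · rw [← mul_smul, ← neg_smul]
    refine smul_eq_of_dvd_sub ⟨c, ?_⟩ hx
    have h1 : (p : ℤ) ^ (M + 1) * (c * (1 - d ^ p ^ b)) = p ^ (M + 1) * (- e * p ^ i) := by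
      have h2 := mul_geom_sum (d ^ p ^ b) (p ^ (n - b))
      rw [← pow_mul, ← hq] at h2
      linear_combination (d ^ p ^ b - 1) * hc - p ^ i * h2 + p ^ i * he
    have h3 := mul_left_cancel₀ (pow_ne_zero _ (by exact_mod_cast hp.ne_zero)) h1
    have h4 : (c : ℤ[X]) * (1 - (d : ℤ[X]) ^ p ^ b) = - e * p ^ i := by
      exact_mod_cast congrArg (Int.cast : ℤ → ℤ[X]) h3
    linear_combination (c : ℤ[X]) * geomPoly_mul d (p ^ b) + h4
  · rw [← mul_smul]
    refine smul_eq_of_dvd_sub (X_pow_sub_one_dvd_of_dvd_prime_mul hp (pow_pos hp.pos b) ?_) hx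
    obtain ⟨g, hg⟩ := X_pow_sub_one_dvd_normCoeff (p := p) h0
    obtain ⟨h, hh⟩ := X_pow_sub_one_dvd_comp_sub_eval_one
      (geomPoly (d ^ p ^ b) (p ^ (n - b))) (p ^ b)
    have hT := geomPoly_mul_length d (p ^ b) (p ^ (n - b))
    rw [← hq] at hT
    have hc' : (p : ℤ[X]) ^ (M + 1) * c =
        p ^ i * (((geomPoly (d ^ p ^ b) (p ^ (n - b))).eval 1 : ℤ) : ℤ[X]) := by
      rw [eval_one_geomPoly]
      exact_mod_cast congrArg (Int.cast : ℤ → ℤ[X]) hc.symm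
    refine ⟨- g - p ^ i * geomPoly d (p ^ b) * h, ?_⟩
    simp only [Nat.add_sub_cancel]
    linear_combination geomPoly d (p ^ b) * hc' - hg - p ^ i * hR - p ^ i * hT
      - p ^ i * geomPoly d (p ^ b) * hh

/-- A solution of the norm equations produces a root of unity on which `σ` acts
through the twist. -/
lemma SatisfiesNormEqs.exists_torsion {p n m M : ℕ} (hp : p.Prime) (hM : 1 ≤ M)
    (hX : ∀ x : A, (X ^ p ^ n - 1 : ℤ[X]) • x = 0) {ξ α : A} {d : ℤ} {δ : ℕ → A}
    (hd : (p : ℤ) ∣ d - 1) (hMd : (p : ℤ) ^ M ∣ d ^ p ^ n - 1)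
    (hδ : ∀ i ≤ m, δ i = 0 ∨ ∃ b ≤ n, (X ^ p ^ b - 1 : ℤ[X]) • δ i = 0 ∧
      (p : ℤ) ^ M ∣ p ^ i * ∑ j ∈ Finset.range (p ^ (n - b)), (d ^ p ^ b) ^ j)
    (h : SatisfiesNormEqs p n m ξ d α δ) :
    ∃ ζ : A, (X - (d : ℤ[X])) • ζ = 0 ∧ (p : ℤ[X]) ^ (M - 1) • ζ = ξ := by
  obtain ⟨h1, h2⟩ := h
  obtain ⟨e, he⟩ := hMd
  obtain ⟨t, ht⟩ := hd
  obtain ⟨R, hR⟩ : (p : ℤ[X]) ∣ geomPoly d (p ^ n) - geomPoly 1 (p ^ n) := by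
    rw [geomPoly, geomPoly, ← Finset.sum_sub_distrib]
    refine Finset.dvd_sum fun j _ => ?_
    rw [← mul_sub, Int.cast_one, one_pow]
    refine Dvd.dvd.mul_left (Dvd.dvd.trans ⟨(t : ℤ[X]), ?_⟩ (sub_one_dvd_pow_sub_one _ _)) _
    exact_mod_cast congrArg (Int.cast : ℤ → ℤ[X]) ht
  have key : ∀ i ∈ Finset.range (m + 1),
      ∃ z : A, (X - (d : ℤ[X])) • z = -(((e : ℤ[X]) * (p : ℤ[X]) ^ i) • δ i) ∧
      (p : ℤ[X]) ^ (M - 1) • z = ((p : ℤ[X]) ^ i * R + normCoeff p n i) • δ i := by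
    intro i hi
    rcases hδ i (by simpa [Nat.lt_succ_iff] using hi) with h0 | ⟨b, hb, hfix, hdvd⟩
    · exact ⟨0, by simp [h0]⟩
    · exact exists_torsion_contribution hp hM hR.symm he.symm hb hdvd hfix
  choose! z hz1 hz2 using key
  refine ⟨(e : ℤ[X]) • α + ∑ i ∈ Finset.range (m + 1), z i, ?_, ?_⟩
  · rw [smul_add, smul_comm, h1, Finset.smul_sum, Finset.smul_sum, ← Finset.sum_add_distrib]
    refine Finset.sum_eq_zero fun i hi => ?_
    rw [hz1 i hi, mul_smul, add_neg_cancel]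
  · rw [smul_add, Finset.smul_sum, Finset.sum_congr rfl hz2]
    simp only [add_smul, Finset.sum_add_distrib]
    rw [h2, ← add_assoc]
    congr 1
    have h3 : ∑ i ∈ Finset.range (m + 1), ((p : ℤ[X]) ^ i * R) • δ i
        = (R * (X - (d : ℤ[X]))) • α := by
      rw [mul_smul, h1, Finset.smul_sum]
      exact Finset.sum_congr rfl fun i _ => by rw [mul_comm, mul_smul]
    rw [h3, ← mul_smul, ← mul_smul, ← add_smul, ht,
      Int.mul_ediv_cancel_left _ (by exact_mod_cast hp.ne_zero)]
    refine smul_eq_of_dvd_sub (X_pow_sub_one_dvd_of_dvd_prime_mul hp (pow_pos hp.pos n) ?_) (hX α)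
    have he' : ((d : ℤ[X])) ^ p ^ n - 1 = p ^ M * e := by
      exact_mod_cast congrArg (Int.cast : ℤ → ℤ[X]) he
    have ht' : (d : ℤ[X]) - 1 = p * t := by
      exact_mod_cast congrArg (Int.cast : ℤ → ℤ[X]) ht
    obtain ⟨M, rfl⟩ : ∃ r, M = r + 1 := ⟨M - 1, by lia⟩
    have hd1 := geomPoly_mul d (p ^ n)
    have hd2 := geomPoly_mul 1 (p ^ n)
    rw [Int.cast_one, one_pow] at hd2
    refine ⟨0, ?_⟩
    simp only [Nat.add_sub_cancel]
    linear_combination - he' + hd1 - hd2 - (X - (d : ℤ[X])) * hR + geomPoly 1 (p ^ n) * ht'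

lemma normCoeff_mul_smul {p n i b r : ℕ} (hbn : b ≤ n) (h0 : i = 0 → b < n)
    (hr : i + (n - b) = r + 1) {x : A} (hx : (X ^ p ^ n - 1 : ℤ[X]) • x = 0) :
    (normCoeff p n i * (geomPoly 1 (p ^ (n - b))).comp (X ^ p ^ b)) • x =
      (p : ℤ[X]) ^ r • geomPoly 1 (p ^ n) • x := by
  have hev (N : ℕ) :
      ((geomPoly 1 (p ^ N)).comp (X ^ p ^ b)).eval 1 = (p : ℤ) ^ N := by
    simp [eval_comp, eval_one_geomPoly]
  cases i with
  | succ i =>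
    simp only [normCoeff]
    rw [mul_assoc, mul_smul, geomPoly_one_mul_smul hx, hev, ← mul_smul]
    congr 1
    push_cast
    rw [← pow_add]
    congr 1
    lia
  | zero =>
    obtain ⟨n, rfl⟩ : ∃ r, n = r + 1 := ⟨n - 1, by have := h0 rfl; lia⟩
    have hb : b ≤ n := by have := h0 rfl; lia
    have e1 := geomPoly_mul_length 1 (p ^ b) (p ^ (n - b))
    rw [← pow_add, Nat.add_sub_cancel' hb, one_pow] at e1
    have e2 := geomPoly_mul_length 1 (p ^ b) (p ^ (n + 1 - b))
    rw [← pow_add, Nat.add_sub_cancel' hbn, one_pow] at e2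
    have e3 : normCoeff p (n + 1) 0 * (geomPoly 1 (p ^ (n + 1 - b))).comp (X ^ p ^ b) =
        geomPoly 1 (p ^ (n + 1)) * (geomPoly 1 (p ^ (n - b))).comp (X ^ p ^ b) := by
      simp only [normCoeff, Nat.add_sub_cancel]
      rw [e1, e2]
      ring
    rw [e3, geomPoly_one_mul_smul hx, hev]
    push_cast
    congr 2
    lia

lemma sum_smul_update_add {s : Finset ℕ} {i : ℕ} (hi : i ∈ s) (c : ℕ → ℤ[X]) (δ : ℕ → A)
    (ε : A) : ∑ j ∈ s, c j • Function.update δ i (δ i + ε) j = ∑ j ∈ s, c j • δ j + c i • ε := by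
  rw [← Finset.add_sum_erase _ _ hi, ← Finset.add_sum_erase s (fun j => c j • δ j) hi,
    Function.update_self, smul_add, add_right_comm]
  congr 2
  refine Finset.sum_congr rfl fun j hj => ?_
  rw [Function.update_of_ne (Finset.ne_of_mem_erase hj)]

/-- If `δ_i` is allowed to vary in `K_b` with `b` large, then the twist `d = d₀ + p^k u` may
be replaced by `d₀` without changing the norm vector. -/
lemma SatisfiesNormEqs.replace_twist {p n m i b k : ℕ} (hp : p.Prime)
    (hX : ∀ x : A, (X ^ p ^ n - 1 : ℤ[X]) • x = 0) {ξ α : A} {d d₀ u : ℤ} {δ : ℕ → A}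
    (hi : i ≤ m) (hk : 1 ≤ k) (hd : d = d₀ + p ^ k * u) (hd₀ : (p : ℤ) ∣ d₀ - 1)
    (hd₀b : d₀ ^ p ^ b = 1) (hbn : b ≤ n) (h0 : i = 0 → b < n) (hle : i + n ≤ k + b)
    (h : SatisfiesNormEqs p n m ξ d α δ) :
    ∃ ε α' : A, (X ^ p ^ b - 1 : ℤ[X]) • ε = 0 ∧
      SatisfiesNormEqs p n m ξ d₀ α' (Function.update δ i (δ i + ε)) := by
  obtain ⟨h1, h2⟩ := h
  obtain ⟨t, ht⟩ := hd₀
  obtain ⟨c, hc⟩ : ∃ c, k = i + (n - b) + c := ⟨k - (i + (n - b)), by lia⟩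
  obtain ⟨k', rfl⟩ : ∃ r, k = r + 1 := ⟨k - 1, by lia⟩
  have hp0 : (p : ℤ) ≠ 0 := by exact_mod_cast hp.ne_zero
  have hi' : i ∈ Finset.range (m + 1) := by simpa [Nat.lt_succ_iff] using hi
  set Q : ℤ[X] := (geomPoly 1 (p ^ (n - b))).comp (X ^ p ^ b) with hQ
  obtain ⟨S, hS⟩ := X_pow_sub_one_dvd_comp_sub_eval_one (geomPoly 1 (p ^ (n - b))) (p ^ b)
  rw [← hQ, eval_one_geomPoly] at hS
  simp only [one_pow, Finset.sum_const, Finset.card_range, nsmul_eq_mul, mul_one, Nat.cast_pow,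
    Int.cast_pow, Int.cast_natCast] at hS
  have hP := geomPoly_mul d₀ (p ^ b)
  have hd₀b' : (d₀ : ℤ[X]) ^ p ^ b = 1 := by exact_mod_cast congrArg (Int.cast : ℤ → ℤ[X]) hd₀b
  rw [hd₀b'] at hP
  have hPe : t * (geomPoly d₀ (p ^ b)).eval 1 = 0 := by
    have h3 := congrArg (eval 1) hP
    simp only [eval_mul, eval_sub, eval_X, eval_intCast, eval_pow, one_pow, eval_one, sub_self]
      at h3
    rw [← neg_sub, neg_mul, neg_eq_zero, Int.cast_id, ht, mul_assoc] at h3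
    exact (mul_eq_zero.1 h3).resolve_left hp0
  set ε : A := ((p : ℤ[X]) ^ c * u * Q) • α with hε
  refine ⟨ε, α + ((u : ℤ[X]) * p ^ (i + c) * (geomPoly d₀ (p ^ b) * S)) • α, ?_, ?_, ?_⟩
  · have h3 := geomPoly_mul_length 1 (p ^ b) (p ^ (n - b))
    rw [← pow_add, Nat.add_sub_cancel' hbn, one_pow, ← hQ] at h3
    have h4 := geomPoly_mul 1 (p ^ b)
    have h5 := geomPoly_mul 1 (p ^ n)
    rw [Int.cast_one, one_pow] at h4 h5
    rw [hε, ← mul_smul, show (X ^ p ^ b - 1 : ℤ[X]) * ((p : ℤ[X]) ^ c * (u : ℤ[X]) * Q) =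
      (p : ℤ[X]) ^ c * (u : ℤ[X]) * (X ^ p ^ n - 1) by rw [← h5, h3, ← h4]; ring, mul_smul,
      hX, smul_zero]
  · rw [sum_smul_update_add hi' (fun j => (p : ℤ[X]) ^ j)]
    rw [← h1, hε, ← mul_smul, smul_add, ← mul_smul, ← add_smul, ← add_smul]
    congr 1
    rw [hd, hc]
    push_cast
    linear_combination (u : ℤ[X]) * p ^ (i + c) * S * hP - (u : ℤ[X]) * p ^ (i + c) * hS
  · have h4 : (d - 1) / p = t + p ^ k' * u := by
      rw [hd]
      refine Int.ediv_eq_of_eq_mul_right hp0 ?_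
      linear_combination ht
    have h5 : (d₀ - 1) / p = t := Int.ediv_eq_of_eq_mul_right hp0 ht
    have h6 : normCoeff p n i • ε = ((p : ℤ[X]) ^ k' * u) • geomPoly 1 (p ^ n) • α := by
      have hr : k' = i + (n - b) - 1 + c := by
        rcases Nat.eq_zero_or_pos i with rfl | hi0
        · have := h0 rfl
          lia
        · lia
      rw [hε, ← mul_smul, show normCoeff p n i * ((p : ℤ[X]) ^ c * (u : ℤ[X]) * Q) =
        ((p : ℤ[X]) ^ c * (u : ℤ[X])) * (normCoeff p n i * Q) by ring, mul_smul,
        normCoeff_mul_smul hbn h0 (r := i + (n - b) - 1) (by lia) (hX α), ← mul_smul, hr]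
      congr 1
      ring
    have h7 : (t : ℤ[X]) • (geomPoly 1 (p ^ n) * (geomPoly d₀ (p ^ b) * S)) • α = 0 := by
      rw [geomPoly_one_mul_smul (hX α), ← mul_smul, eval_mul, ← Int.cast_mul, ← mul_assoc, hPe]
      simp
    rw [sum_smul_update_add hi', h2, h4, h5, h6, smul_add, smul_add,
      ← mul_smul (geomPoly 1 (p ^ n)),
      show geomPoly 1 (p ^ n) * ((u : ℤ[X]) * p ^ (i + c) * (geomPoly d₀ (p ^ b) * S)) =
        ((u : ℤ[X]) * p ^ (i + c)) * (geomPoly 1 (p ^ n) * (geomPoly d₀ (p ^ b) * S)) by ring,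
      mul_smul ((u : ℤ[X]) * p ^ (i + c)), smul_comm (t : ℤ[X]) ((u : ℤ[X]) * p ^ (i + c)), h7]
    push_cast
    rw [add_smul, smul_zero, add_zero]
    abel

lemma SatisfiesNormEqs.truncate {p n m s : ℕ} (hm : 1 ≤ m) (hms : m < s) {ξ α : A} {d : ℤ}
    {δ : ℕ → A} (h : SatisfiesNormEqs p n s ξ d α δ) :
    SatisfiesNormEqs p n m ξ d α
      (fun i => if i < m then δ i else ∑ j ∈ Finset.Icc m s, (p : ℤ[X]) ^ (j - m) • δ j) := by
  have key (c : ℕ → ℤ[X]) (hc : ∀ j, m ≤ j → c j = c m * (p : ℤ[X]) ^ (j - m)) :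
      ∑ i ∈ Finset.range (m + 1),
        c i • (if i < m then δ i else ∑ j ∈ Finset.Icc m s, (p : ℤ[X]) ^ (j - m) • δ j) =
      ∑ i ∈ Finset.range (s + 1), c i • δ i := by
    rw [Finset.sum_range_succ, ← Finset.sum_range_add_sum_Ico _ (show m ≤ s + 1 by lia)]
    simp only [lt_irrefl, if_false, Finset.smul_sum]
    congr 1
    · exact Finset.sum_congr rfl fun i hi => by rw [if_pos (Finset.mem_range.1 hi)]
    · refine Finset.sum_congr (by ext; simp) fun j hj => ?_
      rw [hc j (Finset.mem_Icc.1 hj).1, mul_smul]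
  refine ⟨?_, ?_⟩
  · rw [key (fun i => (p : ℤ[X]) ^ i) fun j hj => by rw [← pow_add, Nat.add_sub_cancel' hj]]
    exact h.1
  · rw [key (normCoeff p n) fun j hj => ?_]
    · exact h.2
    · obtain ⟨m, rfl⟩ : ∃ r, m = r + 1 := ⟨m - 1, by lia⟩
      obtain ⟨t, rfl⟩ := Nat.exists_eq_add_of_le hj
      rw [add_right_comm, show m + t + 1 - (m + 1) = t by lia]
      simp only [normCoeff]
      ring

lemma SatisfiesNormEqs.extend {p n m s : ℕ} (hms : m ≤ s) {ξ α : A} {d : ℤ}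
    {δ : ℕ → A} (h : SatisfiesNormEqs p n m ξ d α δ) :
    SatisfiesNormEqs p n s ξ d α (fun i => if i ≤ m then δ i else 0) := by
  have key (c : ℕ → ℤ[X]) :
      ∑ i ∈ Finset.range (s + 1), c i • (if i ≤ m then δ i else 0) =
      ∑ i ∈ Finset.range (m + 1), c i • δ i := by
    rw [← Finset.sum_subset (Finset.range_mono (Nat.succ_le_succ hms))]
    · exact Finset.sum_congr rfl fun i hi => by
        rw [if_pos (Nat.lt_succ_iff.1 (Finset.mem_range.1 hi))]
    · intro i _ hi
      rw [if_neg (by simpa [Nat.lt_succ_iff] using hi), smul_zero]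
  exact ⟨by rw [key]; exact h.1, by rw [key]; exact h.2⟩

end Module

lemma dvd_geom_sum_of_le {p n b i M : ℕ} {d : ℤ} (hd : (p : ℤ) ∣ d - 1) (hM : M ≤ i + (n - b)) :
    (p : ℤ) ^ M ∣ p ^ i * ∑ j ∈ Finset.range (p ^ (n - b)), (d ^ p ^ b) ^ j := by
  refine (pow_dvd_pow _ hM).trans ?_
  rw [pow_add]
  exact mul_dvd_mul_left _ (prime_pow_dvd_geom_sum (hd.trans (sub_one_dvd_pow_sub_one _ _)) _)

lemma two_pow_dvd_geom_sum {n l : ℕ} {d : ℤ} (hl : 1 ≤ l) (hd : (2 : ℤ) ^ l ∣ d + 1) :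
    (2 : ℤ) ^ (l + n) ∣ ∑ j ∈ Finset.range (2 ^ (n + 1)), d ^ j := by
  rw [pow_succ', geom_sum_mul_length, pow_add]
  refine mul_dvd_mul (by simpa [Finset.sum_range_succ, add_comm] using hd) ?_
  refine mod_cast prime_pow_dvd_geom_sum (p := 2) ?_ n
  have h2 : (2 : ℤ) ∣ d + 1 := (dvd_pow_self _ (by lia)).trans hd
  rw [show d ^ 2 - 1 = (d - 1) * (d + 1) by ring]
  exact mod_cast h2.mul_left _

lemma exists_exact_pow_dvd {q x : ℤ} {j i : ℕ} (hj : q ^ j ∣ x) (hi : ¬ q ^ i ∣ x) :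
    ∃ k, j ≤ k ∧ k < i ∧ q ^ k ∣ x ∧ ¬ q ^ (k + 1) ∣ x := by
  induction i with
  | zero => simp at hi
  | succ i ih =>
    by_cases h : q ^ i ∣ x
    · refine ⟨i, ?_, lt_add_one i, h, hi⟩
      by_contra hlt
      exact hi ((pow_dvd_pow q (by lia)).trans hj)
    · obtain ⟨k, h1, h2, h3⟩ := ih h
      exact ⟨k, h1, h2.trans (lt_add_one i), h3⟩

namespace MSS

variable {F K : Type*} [Field F] [Field K] [Algebra F K]

/-- The action of `σ` on the additively written unit group. -/
def unitsEnd (σ : K ≃ₐ[F] K) : Module.End ℤ (Additive Kˣ) :=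
  (umap σ).toAdditive.toIntLinearMap

/-- The unit group written additively, as a `ℤ[X]`-module where `X` acts by `σ`. -/
def UnitsModule (_σ : K ≃ₐ[F] K) : Type _ := Additive Kˣ

noncomputable instance (σ : K ≃ₐ[F] K) : AddCommGroup (UnitsModule σ) :=
  inferInstanceAs (AddCommGroup (Additive Kˣ))

noncomputable instance (σ : K ≃ₐ[F] K) : Module ℤ[X] (UnitsModule σ) :=
  Module.compHom (Additive Kˣ) (aeval (unitsEnd σ)).toRingHom

/-- The tautological map from the unit group to its additive version. -/
def toAdd (σ : K ≃ₐ[F] K) (x : Kˣ) : UnitsModule σ :=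
  Additive.ofMul x

variable (σ : K ≃ₐ[F] K)

lemma toAdd_mul (x y : Kˣ) : toAdd σ (x * y) = toAdd σ x + toAdd σ y := rfl

lemma toAdd_one : toAdd σ 1 = 0 := rfl

lemma toAdd_zpow (x : Kˣ) (k : ℤ) : toAdd σ (x ^ k) = (k : ℤ[X]) • toAdd σ x := by
  rw [Int.cast_smul_eq_zsmul]
  rfl

lemma toAdd_pow (x : Kˣ) (k : ℕ) : toAdd σ (x ^ k) = (k : ℤ[X]) • toAdd σ x := by
  rw [Nat.cast_smul_eq_nsmul]
  rfl

lemma toAdd_prod (s : Finset ℕ) (f : ℕ → Kˣ) :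
    toAdd σ (∏ i ∈ s, f i) = ∑ i ∈ s, toAdd σ (f i) :=
  ofMul_prod s f

lemma toAdd_injective : Function.Injective (toAdd σ) := fun _ _ h => h

lemma toAdd_surjective : Function.Surjective (toAdd σ) := fun x => ⟨x, rfl⟩

lemma X_smul_toAdd (x : Kˣ) : (X : ℤ[X]) • toAdd σ x = toAdd σ (umap σ x) := by
  change aeval (unitsEnd σ) X (Additive.ofMul x) = _
  rw [aeval_X]
  rfl

lemma X_pow_smul_toAdd (k : ℕ) (x : Kˣ) :
    (X ^ k : ℤ[X]) • toAdd σ x = toAdd σ (umap (σ ^ k) x) := by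
  induction k with
  | zero =>
    rw [pow_zero, one_smul]
    congr 1
  | succ k ih =>
    rw [pow_succ', mul_smul, ih, X_smul_toAdd, pow_succ']
    congr 1

lemma toAdd_normHom (p j : ℕ) (x : Kˣ) :
    toAdd σ (normHom p σ j x) = geomPoly 1 (p ^ j) • toAdd σ x := by
  rw [geomPoly_one, Finset.sum_smul, normHom, MonoidHom.finsetProd_apply, toAdd_prod]
  exact Finset.sum_congr rfl fun k _ => (X_pow_smul_toAdd σ k x).symm

lemma levelMem_coe_iff (p b : ℕ) (x : Kˣ) :
    levelMem p σ (b : WithBot ℕ) x ↔ (X ^ p ^ b - 1 : ℤ[X]) • toAdd σ x = 0 := by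
  change x ∈ KiU p σ b ↔ _
  rw [sub_smul, one_smul, sub_eq_zero, X_pow_smul_toAdd, (toAdd_injective σ).eq_iff, KiU,
    MonoidHom.mem_ker, MonoidHom.div_apply, div_eq_one, MonoidHom.id_apply]

lemma X_pow_orderOf_sub_one_smul {N : ℕ} (h : orderOf σ = N)
    (x : UnitsModule σ) : (X ^ N - 1 : ℤ[X]) • x = 0 := by
  obtain ⟨x, rfl⟩ := toAdd_surjective σ x
  rw [sub_smul, one_smul, sub_eq_zero, X_pow_smul_toAdd, ← h, pow_orderOf_eq_one]
  congr 1

lemma represents_iff {p n m : ℕ} {ξ : Kˣ} {a : Fin m → WithBot ℕ} {d : ℤ} {α : Kˣ}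
    {δ : ℕ → Kˣ} : Represents p n σ ξ a d α δ ↔ (∀ i : Fin m, levelMem p σ (a i) (δ i)) ∧
      SatisfiesNormEqs p n m (toAdd σ ξ) d (toAdd σ α) (fun i => toAdd σ (δ i)) := by
  refine and_congr_right fun _ => and_congr ?_ ?_
  · rw [← (toAdd_injective σ).eq_iff, sub_smul, sub_eq_iff_eq_add', X_smul_toAdd,
      toAdd_mul, toAdd_zpow, toAdd_prod]
    simp only [toAdd_pow, Nat.cast_pow]
  · rw [← (toAdd_injective σ).eq_iff, Finset.range_eq_Ico, Finset.sum_eq_sum_Ico_succ_bot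
      (Nat.succ_pos m), mul_assoc, toAdd_mul, toAdd_mul, toAdd_zpow, toAdd_prod]
    simp only [toAdd_pow, toAdd_normHom]
    have h : ∑ i ∈ Finset.Icc 1 m, ((p ^ (i - 1) : ℕ) : ℤ[X]) • geomPoly 1 (p ^ n) •
        toAdd σ (δ i) = ∑ i ∈ Finset.Ico (0 + 1) (m + 1), normCoeff p n i • toAdd σ (δ i) := by
      refine Finset.sum_congr (by ext; simp) fun i hi => ?_
      obtain ⟨i, rfl⟩ : ∃ r, i = r + 1 := ⟨i - 1, by have := (Finset.mem_Ico.1 hi).1; lia⟩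
      simp [normCoeff, mul_smul]
    rw [h]
    rfl

lemma Represents.exists_torsion {p n m M : ℕ} (hp : p.Prime) (hσ : orderOf σ = p ^ n)
    (hM : 1 ≤ M) (hMm : M ≤ m) {ξ : Kˣ} {a : Fin m → WithBot ℕ} {d : ℤ} {α : Kˣ} {δ : ℕ → Kˣ}
    (ha : ∀ i, a i ≤ (n : WithBot ℕ)) (hd : (p : ℤ) ∣ d - 1) (hMd : (p : ℤ) ^ M ∣ d ^ p ^ n - 1)
    (hcond : ∀ (i : Fin m) (b : ℕ), a i = b →
      (p : ℤ) ^ M ∣ p ^ (i : ℕ) * ∑ j ∈ Finset.range (p ^ (n - b)), (d ^ p ^ b) ^ j)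
    (h : Represents p n σ ξ a d α δ) :
    ∃ ζ : Kˣ, umap σ ζ = ζ ^ d ∧ ζ ^ p ^ (M - 1) = ξ := by
  rw [represents_iff] at h
  obtain ⟨hlev, heqs⟩ := h
  obtain ⟨ζ, h1, h2⟩ := heqs.exists_torsion hp hM (X_pow_orderOf_sub_one_smul σ hσ) hd hMd <| by
    intro i hi
    rcases hi.lt_or_eq with him | rfl
    · have hl := hlev ⟨i, him⟩
      rcases hai : a ⟨i, him⟩ with _ | b
      · rw [hai] at hl
        exact Or.inl (congrArg (toAdd σ) hl)
      · rw [hai] at hl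
        refine Or.inr ⟨b, ?_, (levelMem_coe_iff σ p b _).1 hl, hcond ⟨i, him⟩ b hai⟩
        have := ha ⟨i, him⟩
        rw [hai] at this
        exact WithBot.coe_le_coe.1 this
    · exact Or.inr ⟨n, le_rfl, X_pow_orderOf_sub_one_smul σ hσ _,
        dvd_geom_sum_of_le hd (hMm.trans (Nat.le_add_right _ _))⟩
  obtain ⟨ζ, rfl⟩ := toAdd_surjective σ ζ
  refine ⟨ζ, toAdd_injective σ ?_, toAdd_injective σ ?_⟩
  · rw [← X_smul_toAdd, toAdd_zpow, ← sub_eq_zero, ← sub_smul, h1]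
  · rw [toAdd_pow, ← h2, Nat.cast_pow]

variable {σ}

/-- The twist is determined modulo `p^M` by the action of `σ` on the roots of unity of order
`p^M`. -/
lemma pow_dvd_sub_of_torsion {p M : ℕ} (hp : p.Prime) (hM : 1 ≤ M) {ξ : Kˣ}
    (hξ : orderOf ξ = p) {d d' : ℤ} {ζ ζ' : Kˣ} (h1 : umap σ ζ = ζ ^ d)
    (h2 : ζ ^ p ^ (M - 1) = ξ) (h1' : umap σ ζ' = ζ' ^ d') (h2' : ζ' ^ p ^ (M - 1) = ξ) :
    (p : ℤ) ^ M ∣ d - d' := by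
  have := Fact.mk hp
  obtain ⟨M, rfl⟩ : ∃ r, M = r + 1 := ⟨M - 1, by lia⟩
  rw [Nat.add_sub_cancel] at h2 h2'
  have hord {z : Kˣ} (hz : z ^ p ^ M = ξ) : orderOf z = p ^ (M + 1) := by
    refine orderOf_eq_prime_pow ?_ ?_
    · rw [hz, ← orderOf_eq_one_iff, hξ]
      exact hp.ne_one
    · rw [pow_succ, pow_mul, hz, ← hξ, pow_orderOf_eq_one]
  have hz := IsPrimitiveRoot.orderOf ζ
  have hz' := IsPrimitiveRoot.orderOf ζ'
  rw [hord h2] at hz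
  rw [hord h2'] at hz'
  have hne : NeZero (p ^ (M + 1)) := ⟨pow_ne_zero _ hp.ne_zero⟩
  have hmem : ζ' ∈ Subgroup.zpowers ζ := by
    rw [hz.zpowers_eq, ← hz'.zpowers_eq]
    exact Subgroup.mem_zpowers ζ'
  obtain ⟨t, rfl⟩ := hmem
  have h3 : (ζ ^ t) ^ d = (ζ ^ t) ^ d' := by
    rw [← h1', map_zpow, h1, zpow_comm]
  have h4 := orderOf_dvd_iff_zpow_eq_one.2 (show (ζ ^ t) ^ (d - d') = 1 by
    rw [zpow_sub, h3, mul_inv_cancel])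
  rw [hord h2'] at h4
  exact_mod_cast h4

lemma IsNormPair.pow_dvd_sub {p n m M : ℕ} (hp : p.Prime) (hσ : orderOf σ = p ^ n)
    (hM : 1 ≤ M) (hMm : M ≤ m) {ξ : Kˣ} (hξ : orderOf ξ = p) {a : Fin m → WithBot ℕ} {d d' : ℤ}
    (hMd : ∀ e ∈ ({d, d'} : Set ℤ), (p : ℤ) ^ M ∣ e ^ p ^ n - 1 ∧
      ∀ (i : Fin m) (b : ℕ), a i = b →
        (p : ℤ) ^ M ∣ p ^ (i : ℕ) * ∑ j ∈ Finset.range (p ^ (n - b)), (e ^ p ^ b) ^ j)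
    (h : IsNormPair p n σ ξ a d) (h' : IsNormPair p n σ ξ a d') : (p : ℤ) ^ M ∣ d - d' := by
  obtain ⟨ha, -, hd, α, δ, hr⟩ := h
  obtain ⟨-, -, hd', α', δ', hr'⟩ := h'
  obtain ⟨h1, h2⟩ := hMd d (by simp)
  obtain ⟨h1', h2'⟩ := hMd d' (by simp)
  obtain ⟨ζ, hζ, hζξ⟩ := hr.exists_torsion σ hp hσ hM hMm ha hd h1 h2
  obtain ⟨ζ', hζ', hζξ'⟩ := hr'.exists_torsion σ hp hσ hM hMm ha hd' h1' h2'
  exact pow_dvd_sub_of_torsion hp hM hξ hζ hζξ hζ' hζξ'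

lemma vecLT_irrefl {m : ℕ} (a : Fin m → WithBot ℕ) : ¬ vecLT a a :=
  fun ⟨_, _, h⟩ => lt_irrefl _ h

/-- A minimal norm pair whose twist can be improved to `d₀` has large enough gaps between
the entries of its norm vector and `n`. -/
lemma IsMinimalNormPair.lt_of_not_twistLE {p n s b k : ℕ} (hp : p.Prime)
    (hσ : orderOf σ = p ^ n) {ξ : Kˣ} {a : Fin s → WithBot ℕ} {d d₀ : ℤ}
    (hmin : IsMinimalNormPair p n σ ξ a d) (hk : 1 ≤ k) (hd : (p : ℤ) ^ k ∣ d - d₀)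
    (hd₀ : (p : ℤ) ∣ d₀ - 1) (hd₀b : d₀ ^ p ^ b = 1) (htw : ¬ twistLE p s d d₀)
    (i : Fin s) (hi : a i = b) : k + b < i + n := by
  by_contra! hle
  obtain ⟨⟨ha, ha0, -, α, δ, hr⟩, hmin⟩ := hmin
  obtain ⟨u, hu⟩ := hd
  rw [represents_iff] at hr
  obtain ⟨hlev, heqs⟩ := hr
  have hbn : b ≤ n := WithBot.coe_le_coe.1 (hi.symm.trans_le (ha i))
  have h0 : (i : ℕ) = 0 → b < n := fun h => by
    have := ha0 (Nat.zero_lt_of_lt i.2)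
    rw [show (⟨0, Nat.zero_lt_of_lt i.2⟩ : Fin s) = i from Fin.ext h.symm, hi] at this
    exact WithBot.coe_lt_coe.1 this
  obtain ⟨ε, α', hε, h⟩ := heqs.replace_twist hp (X_pow_orderOf_sub_one_smul σ hσ) i.2.le hk
    (by linear_combination hu : d = d₀ + p ^ k * u) hd₀ hd₀b hbn h0 hle
  obtain ⟨ε, rfl⟩ := toAdd_surjective σ ε
  obtain ⟨α', rfl⟩ := toAdd_surjective σ α'
  have hpair : IsNormPair p n σ ξ a d₀ := by
    refine ⟨ha, ha0, hd₀, α', Function.update δ i (δ i * ε), ?_⟩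
    rw [represents_iff]
    refine ⟨fun j => ?_, ?_⟩
    · rcases eq_or_ne j i with rfl | hj
      · have hlj := hlev j
        rw [hi, levelMem_coe_iff] at hlj ⊢
        rw [Function.update_self, toAdd_mul, smul_add, hlj, hε, add_zero]
      · rw [Function.update_of_ne (by simpa [Fin.ext_iff] using hj)]
        exact hlev j
    · convert h using 1
      funext j
      exact Function.apply_update (fun _ => toAdd σ) δ i _ j
  rcases hmin a d₀ hpair with h | ⟨-, h⟩
  · exact vecLT_irrefl a h
  · exact htw h

lemma Represents.truncate {p n m s : ℕ} (hm : 1 ≤ m) (hms : m < s) {ξ : Kˣ}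
    {a : Fin s → WithBot ℕ} {d : ℤ} {α : Kˣ} {δ : ℕ → Kˣ} (h : Represents p n σ ξ a d α δ) :
    Represents p n σ ξ (fun j : Fin m => a (Fin.castLE hms.le j)) d α
      (fun i => if i < m then δ i else ∏ j ∈ Finset.Icc m s, δ j ^ p ^ (j - m)) := by
  rw [represents_iff] at h ⊢
  refine ⟨fun i => ?_, ?_⟩
  · rw [if_pos i.2]
    exact h.1 (Fin.castLE hms.le i)
  · convert h.2.truncate hm hms using 2 with i
    split_ifs
    · rfl
    · simp only [toAdd_prod, toAdd_pow, Nat.cast_pow]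

/-- The norm vector of length `s` obtained from one of length `m` by appending
`n, -∞, …, -∞`. -/
def extendVec (n : ℕ) {m : ℕ} (s : ℕ) (a : Fin m → WithBot ℕ) (j : Fin s) : WithBot ℕ :=
  if h : (j : ℕ) < m then a ⟨j, h⟩ else if (j : ℕ) = m then n else ⊥

lemma extendVec_of_lt (n : ℕ) {m s : ℕ} (a : Fin m → WithBot ℕ) {j : Fin s} (h : (j : ℕ) < m) :
    extendVec n s a j = a ⟨j, h⟩ := dif_pos h

lemma IsNormPair.extend {p n m s : ℕ} (hσ : orderOf σ = p ^ n) (hm : 1 ≤ m) (hms : m < s)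
    {ξ : Kˣ} {a : Fin m → WithBot ℕ} {d : ℤ} (h : IsNormPair p n σ ξ a d) :
    IsNormPair p n σ ξ (extendVec n s a) d := by
  obtain ⟨ha, ha0, hd, α, δ, hr⟩ := h
  rw [represents_iff] at hr
  refine ⟨fun i => ?_, fun h0 => ?_, hd, α, fun i => if i ≤ m then δ i else 1, ?_⟩
  · unfold extendVec
    split_ifs
    · exact ha _
    · exact le_rfl
    · exact bot_le
  · rw [extendVec_of_lt n a (j := ⟨0, h0⟩) hm]
    exact ha0 hm
  · rw [represents_iff]
    refine ⟨fun i => ?_, ?_⟩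
    · unfold extendVec
      split_ifs with h1 h2 h3 h4 h5
      · exact hr.1 ⟨i, h1⟩
      · lia
      · exact (levelMem_coe_iff σ p n _).2 (X_pow_orderOf_sub_one_smul σ hσ _)
      · lia
      · lia
      · rfl
    · convert hr.2.extend hms.le using 2 with i
      split_ifs
      · rfl
      · exact toAdd_one σ

/-- Truncating a minimal norm pair does not spoil the minimality of the twist. -/
lemma IsMinimalNormPair.twistLE_of_truncate {p n m s : ℕ} (hp : p.Prime) (hn : 0 < n)
    (hσ : orderOf σ = p ^ n) (hm : 1 ≤ m) (hms : m < s) {ξ : Kˣ} (hξ : orderOf ξ = p)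
    {a : Fin s → WithBot ℕ} {d d' : ℤ} (hmin : IsMinimalNormPair p n σ ξ a d)
    (h' : IsNormPair p n σ ξ (fun j : Fin m => a (Fin.castLE hms.le j)) d') :
    twistLE p m d d' := by
  have hpair : IsNormPair p n σ ξ (fun j : Fin m => a (Fin.castLE hms.le j)) d := by
    obtain ⟨⟨ha, ha0, hd, α, δ, hr⟩, -⟩ := hmin
    exact ⟨fun i => ha _, fun _ => ha0 (by lia), hd, α, _, hr.truncate hm hms⟩
  have hd := hpair.2.2.1
  have hd' := h'.2.2.1
  have hbn {i : Fin m} {b : ℕ} (hi : a (Fin.castLE hms.le i) = b) : b ≤ n :=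
    WithBot.coe_le_coe.1 (hi.symm.trans_le (hpair.1 i))
  have gap_one {k : ℕ} (hk : 1 ≤ k) (hks : k + 1 ≤ s) (hkd : (p : ℤ) ^ k ∣ d - 1)
      (hkd' : ¬ (p : ℤ) ^ (k + 1) ∣ d - 1) (i : Fin m) {b : ℕ}
      (hi : a (Fin.castLE hms.le i) = b) : k + b < i + n := by
    refine hmin.lt_of_not_twistLE hp hσ hk hkd (by simp) (one_pow _) (fun htw => ?_) _ hi
    exact hkd' (htw.2 (by simp) (k + 1) (by lia) hks (by simp))
  constructor
  · rintro ⟨rfl, h4, h4'⟩ i hi2 him hid'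
    by_contra hid
    have hd4 : (2 : ℤ) ^ 2 ∣ d + 1 := by
      norm_num at hd h4 ⊢
      lia
    obtain ⟨l, hl2, hli, hld, hld'⟩ := exists_exact_pow_dvd hd4 hid
    have hlid' : (2 : ℤ) ^ (l + 1) ∣ d' + 1 := (pow_dvd_pow _ hli).trans hid'
    have hmem : ∀ e ∈ ({d, d'} : Set ℤ), (2 : ℤ) ^ l ∣ e + 1 := by
      rintro e (rfl | rfl)
      · exact hld
      · exact (pow_dvd_pow _ (Nat.le_succ l)).trans hlid'
    have hsub := hpair.pow_dvd_sub hp hσ (M := l + 1) (by lia) (by lia) hξ ?_ h'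
    · exact hld' (by simpa [← add_assoc] using dvd_add hsub hlid')
    · intro e he
      have hel := hmem e he
      have he2 : (2 : ℤ) ∣ e - 1 := by
        have := (dvd_pow_self (2 : ℤ) (show l ≠ 0 by lia)).trans hel
        lia
      refine ⟨?_, fun j b hj => ?_⟩
      · have h2 : (2 : ℤ) ^ (l + 1) ∣ e ^ 2 - 1 := by
          rw [pow_succ, show e ^ 2 - 1 = (e + 1) * (e - 1) by ring]
          exact mul_dvd_mul hel he2
        obtain ⟨r, rfl⟩ : ∃ r, n = r + 1 := ⟨n - 1, by lia⟩
        rw [pow_succ' 2 r, pow_mul]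
        exact h2.trans (sub_one_dvd_pow_sub_one _ _)
      · rcases Nat.eq_zero_or_pos b with rfl | hb
        · have hgap := gap_one (k := 1) le_rfl (by lia) (by simpa using hd)
            (by norm_num at h4 ⊢; exact h4) j hj
          obtain ⟨r, rfl⟩ : ∃ r, n = r + 1 := ⟨n - 1, by lia⟩
          simp only [pow_zero, pow_one, Nat.sub_zero, Nat.cast_ofNat]
          refine (pow_dvd_pow _ (by lia : l + 1 ≤ j + (l + r))).trans ?_
          rw [pow_add]
          exact mul_dvd_mul_left _ (two_pow_dvd_geom_sum (by lia) hel)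
        · have hgap := hmin.lt_of_not_twistLE hp hσ (k := l) (d₀ := -1) (b := b) (by lia)
            (by simpa using hld) (by norm_num)
            (Even.neg_one_pow ((Nat.even_pow' hb.ne').2 even_two))
            (fun htw => hld' (htw.1 ⟨rfl, h4, by norm_num⟩ (l + 1) (by lia) (by lia) (by simp)))
            _ hj
          have := hbn hj
          refine dvd_geom_sum_of_le (mod_cast he2) ?_
          rw [Fin.val_castLE] at hgap
          lia
  · intro _ i hi1 him hid'
    by_contra hid
    obtain ⟨k, hk1, hki, hkd, hkd'⟩ := exists_exact_pow_dvd (j := 1) (by simpa using hd) hid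
    have hkid' : (p : ℤ) ^ (k + 1) ∣ d' - 1 := (pow_dvd_pow _ hki).trans hid'
    have hmem : ∀ e ∈ ({d, d'} : Set ℤ), (p : ℤ) ^ k ∣ e - 1 := by
      rintro e (rfl | rfl)
      · exact hkd
      · exact (pow_dvd_pow _ (Nat.le_succ k)).trans hkid'
    have hsub := hpair.pow_dvd_sub hp hσ (M := k + 1) (by lia) (by lia) hξ ?_ h'
    · exact hkd' (by simpa using dvd_add hsub hkid')
    · intro e he
      refine ⟨(pow_dvd_pow _ (by lia)).trans (prime_pow_dvd_pow_sub_one hk1 (hmem e he) n),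
        fun j b hj => dvd_geom_sum_of_le ((dvd_pow_self _ (by lia)).trans (hmem e he)) ?_⟩
      have := gap_one hk1 (by lia) hkd hkd' j hj
      have := hbn hj
      lia

/-- Truncations of minimal norm pairs are minimal. -/
lemma IsMinimalNormPair.truncate {p n m s : ℕ} (hp : p.Prime) (hn : 0 < n)
    (hσ : orderOf σ = p ^ n) (hm : 1 ≤ m) (hms : m < s) {ξ : Kˣ} (hξ : orderOf ξ = p)
    {a : Fin s → WithBot ℕ} {d : ℤ} (hmin : IsMinimalNormPair p n σ ξ a d) :
    IsMinimalNormPair p n σ ξ (fun j : Fin m => a (Fin.castLE hms.le j)) d := by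
  have ⟨⟨ha, ha0, hd, α, δ, hr⟩, hle⟩ := hmin
  refine ⟨⟨fun i => ha _, fun _ => ha0 (by lia), hd, α, _, hr.truncate hm hms⟩,
    fun a' d' h' => ?_⟩
  have heq {k : ℕ} (hk : m ≤ k)
      (h : ∀ j : Fin s, (j : ℕ) < k → a j = extendVec n s a' j) :
      (fun j : Fin m => a (Fin.castLE hms.le j)) = a' := by
    funext j
    rw [h _ (j.2.trans_le hk), extendVec_of_lt n a' (by exact j.2)]
    rfl
  have hfin (h : (fun j : Fin m => a (Fin.castLE hms.le j)) = a') :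
      pairLE p (fun j : Fin m => a (Fin.castLE hms.le j)) d a' d' := by
    subst h
    exact Or.inr ⟨rfl, hmin.twistLE_of_truncate hp hn hσ hm hms hξ h'⟩
  rcases hle _ d' (h'.extend hσ hm hms) with ⟨k, hk, hlt⟩ | ⟨h, -⟩
  · rcases lt_or_ge (k : ℕ) m with hkm | hkm
    · refine Or.inl ⟨⟨k, hkm⟩, fun j hj => ?_, ?_⟩
      · have := hk (Fin.castLE hms.le j) hj
        rwa [extendVec_of_lt n a' (by exact j.2)] at this
      · rwa [extendVec_of_lt n a' hkm] at hlt
    · exact hfin (heq hkm hk)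
  · exact hfin (heq hms.le fun j _ => congrFun h j)

end MSS

end Contraction

universe u v

/-- **Corollary (contraction of exceptional elements).**  If
`(α, {δ̌_i}_{i=0}^s)` represents a minimal norm pair `(a, d)` of length `s` and
`1 ≤ m < s`, then `α` is `m`-exceptional; more precisely
`(α, {δ_i}_{i=0}^m)` represents the minimal norm pair `((a_0,…,a_{m-1}), d)` of
length `m`, where `δ_i = δ̌_i` for `i < m` and `δ_m = ∏_{i=m}^s δ̌_i^{p^{i-m}}`. -/
theorem statement_6 {F : Type u} {K : Type v} [Field F] [Field K] [Algebra F K]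
    [IsGalois F K] [FiniteDimensional F K]
    (p n m s : ℕ) (hp : p.Prime) (hn : 0 < n) (hm : 1 ≤ m) (hms : m < s)
    (σ : K ≃ₐ[F] K) (horder : orderOf σ = p ^ n)
    (hgen : ∀ τ : K ≃ₐ[F] K, τ ∈ Subgroup.zpowers σ)
    (ξ : Kˣ) (hξ : IsPrimitiveRoot (ξ : K) p)
    (hξF : (ξ : K) ∈ Set.range (algebraMap F K))
    (hspecial : p = 2 → n = 1 → ∃ γ : Kˣ, MSS.normHom p σ n γ = -1)
    (a : Fin s → WithBot ℕ) (d : ℤ) (α : Kˣ) (δc : ℕ → Kˣ)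
    (hmin : MSS.IsMinimalNormPair p n σ ξ a d)
    (hrep : MSS.Represents p n σ ξ a d α δc) :
    MSS.IsExceptional p n σ ξ m α ∧
    MSS.Represents p n σ ξ (fun j : Fin m => a (Fin.castLE hms.le j)) d α
      (fun i => if i < m then δc i else ∏ j ∈ Finset.Icc m s, δc j ^ p ^ (j - m)) ∧
    MSS.IsMinimalNormPair p n σ ξ (fun j : Fin m => a (Fin.castLE hms.le j)) d := by
  have hξ' : orderOf ξ = p := by
    rw [← orderOf_units]
    exact hξ.eq_orderOf.symm
  have hr := hrep.truncate hm hms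
  have hmin' := hmin.truncate hp hn horder hm hms hξ'
  exact ⟨⟨_, d, _, hmin', hr⟩, hr, hmin'⟩
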